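/- Let ρ and ν be probability measures on ℝ^n. Then the squared 2-Wasserstein distance between ρ and ν is bounded by four times the sum of their relative entropies with respect to the standard Gaussian measure: inf{ ∫ |x−y|² dγ(x,y) : γ a coupling of (ρ, ν) } ≤ 4·( H(ρ|β) + H(ν|β) ), as an inequality in [0, ∞]. -/

import Mathlib

open MeasureTheory Real Filter Topology

/-- The standard Gaussian measure on `ℝ^n`, i.e. the measure with density
`(2π)^(-n/2) exp(-|x|²/2)` with respect to Lebesgue measure. -/
noncomputable def stdGaussian (n : ℕ) : Measure (Fin n → ℝ) :=
  volume.withDensity fun x =>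
    ENNReal.ofReal ((2 * π) ^ (-(n : ℝ) / 2) * Real.exp (-(∑ i, x i ^ 2) / 2))

/-- The gradient of `f : ℝ^n → ℝ`, given coordinatewise by `(∇f)(x)ᵢ = ∂ᵢf(x)`. -/
noncomputable def grad {n : ℕ} (f : (Fin n → ℝ) → ℝ) (x : Fin n → ℝ) : Fin n → ℝ :=
  fun i => fderiv ℝ f x (Pi.single i 1)

/-- The Hessian matrix of `f : ℝ^n → ℝ`. -/
noncomputable def hess {n : ℕ} (f : (Fin n → ℝ) → ℝ) (x : Fin n → ℝ) :
    Matrix (Fin n) (Fin n) ℝ :=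
  Matrix.of fun i j => fderiv ℝ (fun y => grad f y j) x (Pi.single i 1)

/-- The Jacobian matrix of a vector field `ξ : ℝ^n → ℝ^n`:
`(Dξ)(x)ᵢⱼ = ∂ⱼξᵢ(x)`. -/
noncomputable def jac {n : ℕ} (ξ : (Fin n → ℝ) → Fin n → ℝ) (x : Fin n → ℝ) :
    Matrix (Fin n) (Fin n) ℝ :=
  Matrix.of fun i j => fderiv ℝ (fun y => ξ y i) x (Pi.single j 1)

open scoped Classical in
/-- The relative entropy `H(m₁ | m₂) = ∫ log(dm₁/dm₂) dm₁` if `m₁ ≪ m₂`, `+∞`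
otherwise, computed with values in `[0, ∞]` via the nonnegative integrand
`r log r − r + 1` of the Radon–Nikodym derivative `r = dm₁/dm₂`. -/
noncomputable def relEntropy {α : Type*} [MeasurableSpace α]
    (m₁ m₂ : Measure α) : ENNReal :=
  if m₁ ≪ m₂ then
    ∫⁻ x, ENNReal.ofReal ((m₁.rnDeriv m₂ x).toReal * Real.log (m₁.rnDeriv m₂ x).toReal
      - (m₁.rnDeriv m₂ x).toReal + 1) ∂m₂
  else ⊤

section QuantileFunction

open Set ProbabilityTheory InformationTheory
open scoped ENNReal NNReal

/-- The quantile function of a measure on `ℝ`, set to `0` outside `(0, 1)`. -/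
noncomputable def quantile (μ : Measure ℝ) (u : ℝ) : ℝ :=
  if u ∈ Ioo (0 : ℝ) 1 then sInf {x | u ≤ cdf μ x} else 0

theorem quantile_le_iff (μ : Measure ℝ) {u : ℝ} (hu : u ∈ Ioo (0 : ℝ) 1) (x : ℝ) :
    quantile μ u ≤ x ↔ u ≤ cdf μ x := by
  have hne : {x | u ≤ cdf μ x}.Nonempty :=
    ((tendsto_cdf_atTop μ).eventually (eventually_ge_nhds hu.2)).exists
  have hbdd : BddBelow {x | u ≤ cdf μ x} := by
    obtain ⟨b, hb⟩ := ((tendsto_cdf_atBot μ).eventually (eventually_lt_nhds hu.1)).exists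
    exact ⟨b, fun x hx ↦ le_of_not_gt fun hxb ↦
      absurd (hx.trans (monotone_cdf μ hxb.le)) (not_le.2 hb)⟩
  rw [quantile, if_pos hu]
  refine ⟨fun h ↦ ?_, fun h ↦ csInf_le hbdd h⟩
  have hgt : ∀ᶠ y in 𝓝[>] x, u ≤ cdf μ y := by
    filter_upwards [self_mem_nhdsWithin] with y hy
    obtain ⟨z, hz, hzy⟩ := exists_lt_of_csInf_lt hne (h.trans_lt hy)
    exact hz.trans (monotone_cdf μ hzy.le)
  exact ge_of_tendsto (((cdf μ).right_continuous x).mono Ioi_subset_Ici_self) hgt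

theorem monotoneOn_quantile (μ : Measure ℝ) : MonotoneOn (quantile μ) (Ioo 0 1) :=
  fun _ hu _ hv huv ↦ (quantile_le_iff μ hu _).2 (huv.trans ((quantile_le_iff μ hv _).1 le_rfl))

theorem measurable_quantile_kernel {α : Type*} [MeasurableSpace α] (κ : Kernel α ℝ)
    [IsMarkovKernel κ] : Measurable fun p : α × ℝ ↦ quantile (κ p.1) p.2 := by
  refine measurable_of_Iic fun x ↦ ?_
  have hI : MeasurableSet {p : α × ℝ | p.2 ∈ Ioo (0 : ℝ) 1} := measurable_snd measurableSet_Ioo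
  have hF : MeasurableSet {p : α × ℝ | p.2 ≤ cdf (κ p.1) x} := by
    refine measurableSet_le measurable_snd ?_
    simp_rw [cdf_eq_real, measureReal_def]
    exact ((κ.measurable_coe measurableSet_Iic).comp measurable_fst).ennreal_toReal
  have h0 : MeasurableSet {_p : α × ℝ | (0 : ℝ) ≤ x} := MeasurableSet.const _
  convert (hI.inter hF).union (hI.compl.inter h0) using 1
  ext p
  by_cases hp : p.2 ∈ Ioo (0 : ℝ) 1
  · simp only [mem_preimage, mem_Iic, quantile_le_iff _ hp, mem_union, mem_inter_iff,
      mem_ofPred_eq, mem_compl_iff, hp, true_and, not_true, false_and, or_false]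
  · simp only [mem_preimage, mem_Iic, quantile, mem_union, mem_inter_iff,
      mem_ofPred_eq, mem_compl_iff, hp, false_and, not_false_eq_true, true_and, false_or, if_false]

theorem measurable_quantile (μ : Measure ℝ) [IsProbabilityMeasure μ] : Measurable (quantile μ) :=
  (measurable_quantile_kernel (Kernel.const Unit μ)).comp
    (measurable_const (a := ()).prodMk measurable_id)

instance : IsProbabilityMeasure (volume.restrict (Ioo (0 : ℝ) 1)) := ⟨by simp⟩

theorem map_quantile (μ : Measure ℝ) [IsProbabilityMeasure μ] :
    (volume.restrict (Ioo (0 : ℝ) 1)).map (quantile μ) = μ := by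
  have := Measure.isProbabilityMeasure_map (μ := volume.restrict (Ioo (0 : ℝ) 1))
    (measurable_quantile μ).aemeasurable
  refine Measure.ext_of_Iic _ _ fun x ↦ ?_
  rw [Measure.map_apply (measurable_quantile μ) measurableSet_Iic,
    Measure.restrict_apply (measurable_quantile μ measurableSet_Iic), ← ofReal_cdf]
  refine le_antisymm ?_ ?_
  · calc volume (quantile μ ⁻¹' Iic x ∩ Ioo 0 1) ≤ volume (Ioc 0 (cdf μ x)) :=
          measure_mono fun u hu ↦ ⟨hu.2.1, (quantile_le_iff μ hu.2 x).1 hu.1⟩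
      _ = _ := by simp
  · calc ENNReal.ofReal (cdf μ x) = volume (Ioo 0 (cdf μ x)) := by simp
      _ ≤ volume (quantile μ ⁻¹' Iic x ∩ Ioo 0 1) := by
          refine measure_mono fun u hu ↦ ?_
          have hu' : u ∈ Ioo (0 : ℝ) 1 := ⟨hu.1, hu.2.trans_le (cdf_le_one μ x)⟩
          exact ⟨(quantile_le_iff μ hu' x).2 hu.2.le, hu'⟩

theorem cdf_quantile (μ : Measure ℝ) [IsProbabilityMeasure μ] [NullSingletonClass μ] {u : ℝ}
    (hu : u ∈ Ioo (0 : ℝ) 1) : cdf μ (quantile μ u) = u := by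
  refine le_antisymm ?_ ((quantile_le_iff μ hu _).1 le_rfl)
  set q := quantile μ u
  have hq : Function.leftLim (cdf μ) q = cdf μ q := by
    have h := (cdf μ).measure_singleton q
    rw [measure_cdf, measure_singleton, eq_comm, ENNReal.ofReal_eq_zero, sub_nonpos] at h
    exact le_antisymm ((monotone_cdf μ).leftLim_le le_rfl) h
  rw [← hq]
  refine le_of_tendsto ((monotone_cdf μ).tendsto_leftLim q) ?_
  filter_upwards [self_mem_nhdsWithin] with x hx
  exact le_of_not_ge fun h ↦ absurd ((quantile_le_iff μ hu x).2 h) (not_le.2 hx)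

/-- The derivative of the quantile function is the inverse of the Lebesgue density. -/
theorem ae_hasDerivAt_quantile (μ : Measure ℝ) [IsProbabilityMeasure μ] (hμ : μ ≪ volume) :
    ∀ᵐ u ∂(volume.restrict (Ioo (0 : ℝ) 1)),
      HasDerivAt (quantile μ) (μ.rnDeriv volume (quantile μ u)).toReal⁻¹ u := by
  have : NullSingletonClass μ := ⟨fun x ↦ hμ (measure_singleton x)⟩
  have hF : ∀ᵐ x ∂μ, HasDerivAt (cdf μ) (μ.rnDeriv volume x).toReal x ∧
      (μ.rnDeriv volume x).toReal ≠ 0 := by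
    have hd := (cdf μ).ae_hasDerivAt
    rw [measure_cdf] at hd
    filter_upwards [hμ.ae_le hd, Measure.rnDeriv_pos hμ, hμ.ae_le (μ.rnDeriv_ne_top volume)]
      with x h1 h2 h3
    exact ⟨h1, (ENNReal.toReal_pos h2.ne' h3).ne'⟩
  rw [← map_quantile μ] at hF
  have hF' := ae_of_ae_map (measurable_quantile μ).aemeasurable hF
  rw [map_quantile μ] at hF'
  have hc : ∀ᵐ u : ℝ, u ∉ {u ∈ Ioo (0 : ℝ) 1 | ¬ContinuousWithinAt (quantile μ) (Ioo 0 1) u} :=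
    (monotoneOn_quantile μ).countable_not_continuousWithinAt.ae_notMem _
  filter_upwards [hF', ae_restrict_of_ae hc, ae_restrict_mem measurableSet_Ioo] with u h1 h2 hu
  have hcont : ContinuousWithinAt (quantile μ) (Ioo 0 1) u := by_contra fun h ↦ h2 ⟨hu, h⟩
  refine HasDerivAt.of_local_left_inverse (hcont.continuousAt (Ioo_mem_nhds hu.1 hu.2))
    h1.1 h1.2 ?_
  filter_upwards [Ioo_mem_nhds hu.1 hu.2] with v hv using cdf_quantile μ hv

end QuantileFunction

section OneDimensional

open Set ProbabilityTheory InformationTheory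
open scoped ENNReal NNReal

theorem MonotoneOn.integral_deriv_Ioo_le_one {f : ℝ → ℝ} (hf : MonotoneOn f (Ioo 0 1))
    (h0 : ∀ x, 0 ≤ f x) (h1 : ∀ x, f x ≤ 1) :
    IntegrableOn (deriv f) (Ioo 0 1) ∧ ∫ u in Ioo (0 : ℝ) 1, deriv f u ≤ 1 := by
  let g : ℝ → ℝ := fun u ↦ if u ≤ 0 then 0 else if 1 ≤ u then 1 else f u
  have hg : Monotone g := by
    intro x y hxy
    simp only [g]
    split_ifs with hx hy hy' hx' hy hy' hy hy'
    · exact le_rfl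
    · exact zero_le_one
    · exact h0 y
    · linarith
    · exact le_rfl
    · linarith
    · linarith
    · exact h1 x
    · exact hf ⟨by linarith, by linarith⟩ ⟨by linarith, by linarith⟩ hxy
  have hfg : EqOn (deriv g) (deriv f) (Ioo 0 1) := by
    intro u hu
    refine Filter.EventuallyEq.deriv_eq ?_
    filter_upwards [Ioo_mem_nhds hu.1 hu.2] with v hv
    simp [g, not_le.2 hv.1, not_le.2 hv.2]
  have hint := (hg.monotoneOn (uIcc 0 1)).intervalIntegrable_deriv
  have hval := (hg.monotoneOn (uIcc 0 1)).intervalIntegral_deriv_mem_uIcc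
  rw [intervalIntegrable_iff_integrableOn_Ioo_of_le zero_le_one] at hint
  rw [intervalIntegral.integral_of_le zero_le_one, integral_Ioc_eq_integral_Ioo,
    setIntegral_congr_fun measurableSet_Ioo hfg] at hval
  refine ⟨hint.congr_fun hfg measurableSet_Ioo, ?_⟩
  have hg0 : g 0 = 0 := by simp [g]
  have hg1 : g 1 = 1 := by simp [g, not_le.2 zero_lt_one]
  rw [hg0, hg1, sub_zero, uIcc_of_le zero_le_one] at hval
  exact hval.2

theorem hasDerivAt_cdf_gaussianReal (x : ℝ) :
    HasDerivAt (cdf (gaussianReal 0 1)) (gaussianPDFReal 0 1 x) x := by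
  have hcont : Continuous (gaussianPDFReal 0 1) := by
    rw [gaussianPDFReal_def]
    fun_prop
  have heq : (cdf (gaussianReal 0 1) : ℝ → ℝ) = fun y ↦ cdf (gaussianReal 0 1) x +
      ∫ t in x..y, gaussianPDFReal 0 1 t := by
    have hcdf (y : ℝ) : cdf (gaussianReal 0 1) y = ∫ t in Iic y, gaussianPDFReal 0 1 t := by
      rw [cdf_eq_real, measureReal_def, gaussianReal_apply_eq_integral _ one_ne_zero,
        ENNReal.toReal_ofReal]
      exact integral_nonneg fun t ↦ gaussianPDFReal_nonneg 0 1 t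
    funext y
    rw [hcdf, hcdf, ← intervalIntegral.integral_Iic_sub_Iic
      (integrable_gaussianPDFReal 0 1).integrableOn (integrable_gaussianPDFReal 0 1).integrableOn]
    ring
  rw [heq]
  exact ((hcont.integral_hasStrictDerivAt x x).hasDerivAt).const_add _

theorem log_gaussianPDFReal (x : ℝ) :
    Real.log (gaussianPDFReal 0 1 x) = Real.log (√(2 * π))⁻¹ - x ^ 2 / 2 := by
  rw [gaussianPDFReal_def, Real.log_mul (by positivity) (by positivity), Real.log_exp]
  simp
  ring

/-- A pointwise consequence of the inequality of arithmetic and geometric means and of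
`log t ≤ t - 1`. -/
theorem sq_sub_le_log_add_log_add (a b : ℝ) {f g : ℝ} (hf : 0 < f) (hg : 0 < g) :
    (a - b) ^ 2 ≤ 4 * (Real.log f + Real.log g) +
      8 * (gaussianPDFReal 0 1 ((a + b) / 2) *
        (((f * gaussianPDFReal 0 1 a)⁻¹ + (g * gaussianPDFReal 0 1 b)⁻¹) / 2) - 1) := by
  have hφ (x : ℝ) : 0 < gaussianPDFReal 0 1 x := gaussianPDFReal_pos 0 1 x one_ne_zero
  set p := (f * gaussianPDFReal 0 1 a)⁻¹ with hp_def
  set q := (g * gaussianPDFReal 0 1 b)⁻¹ with hq_def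
  have hp : 0 < p := inv_pos.2 (mul_pos hf (hφ a))
  have hq : 0 < q := inv_pos.2 (mul_pos hg (hφ b))
  have hlogp : Real.log p = -(Real.log f + Real.log (gaussianPDFReal 0 1 a)) := by
    rw [hp_def, Real.log_inv, Real.log_mul hf.ne' (hφ a).ne']
  have hlogq : Real.log q = -(Real.log g + Real.log (gaussianPDFReal 0 1 b)) := by
    rw [hq_def, Real.log_inv, Real.log_mul hg.ne' (hφ b).ne']
  have hamgm : Real.log p + Real.log q ≤ 2 * Real.log ((p + q) / 2) := by
    rw [← Real.log_mul hp.ne' hq.ne', ← Real.log_rpow (by positivity)]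
    refine Real.log_le_log (by positivity) ?_
    norm_num
    nlinarith [sq_nonneg (p - q)]
  have hlog := Real.log_le_sub_one_of_pos
    (mul_pos (hφ ((a + b) / 2)) (half_pos (add_pos hp hq)))
  rw [Real.log_mul (hφ _).ne' (by positivity)] at hlog
  rw [log_gaussianPDFReal] at hlog hlogp hlogq
  nlinarith

/-- The monotone coupling of two measures on `ℝ` has transport cost bounded by their entropies
relative to the Gaussian. -/
theorem lintegral_sq_sub_quantile_le (μ ν : Measure ℝ) [IsProbabilityMeasure μ]
    [IsProbabilityMeasure ν] :
    ∫⁻ u in Ioo (0 : ℝ) 1, ENNReal.ofReal ((quantile μ u - quantile ν u) ^ 2) ≤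
      4 * (klDiv μ (gaussianReal 0 1) + klDiv ν (gaussianReal 0 1)) := by
  set γ := gaussianReal 0 1
  by_cases hμ : klDiv μ γ = ∞
  · simp [hμ]
  by_cases hν : klDiv ν γ = ∞
  · simp [hν]
  have hγ : γ ≪ volume := gaussianReal_absolutelyContinuous 0 one_ne_zero
  have key (ρ : Measure ℝ) [IsProbabilityMeasure ρ] (hρ : klDiv ρ γ ≠ ∞) :
      klDiv ρ γ = ENNReal.ofReal (∫ u in Ioo (0 : ℝ) 1, llr ρ γ (quantile ρ u)) ∧
      IntegrableOn (fun u ↦ llr ρ γ (quantile ρ u)) (Ioo 0 1) ∧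
      0 ≤ ∫ u in Ioo (0 : ℝ) 1, llr ρ γ (quantile ρ u) ∧
      ∀ᵐ u ∂(volume.restrict (Ioo (0 : ℝ) 1)), ∃ f : ℝ, 0 < f ∧
        llr ρ γ (quantile ρ u) = Real.log f ∧
        HasDerivAt (quantile ρ) (f * gaussianPDFReal 0 1 (quantile ρ u))⁻¹ u := by
    obtain ⟨hac, hint⟩ := klDiv_ne_top_iff.1 hρ
    have hmp : MeasurePreserving (quantile ρ) (volume.restrict (Ioo (0 : ℝ) 1)) ρ :=
      ⟨measurable_quantile ρ, map_quantile ρ⟩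
    have hI : ∫ u in Ioo (0 : ℝ) 1, llr ρ γ (quantile ρ u) = ∫ x, llr ρ γ x ∂ρ := by
      have h := integral_map (μ := volume.restrict (Ioo (0 : ℝ) 1))
        (measurable_quantile ρ).aemeasurable (measurable_llr ρ γ).aestronglyMeasurable
      rw [map_quantile ρ] at h
      exact h.symm
    refine ⟨?_, hmp.integrable_comp_of_integrable hint, ?_, ?_⟩
    · rw [klDiv_of_ac_of_integrable hac hint, hI]
      simp
    · rw [hI]
      have := integral_llr_add_sub_measure_univ_nonneg hac hint
      simpa using this
    · have h1 : ∀ᵐ x ∂ρ, 0 < (ρ.rnDeriv γ x).toReal ∧ (ρ.rnDeriv volume x).toReal =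
          (ρ.rnDeriv γ x).toReal * gaussianPDFReal 0 1 x := by
        filter_upwards [Measure.rnDeriv_pos hac, hac.ae_le (ρ.rnDeriv_ne_top γ),
          (hac.trans hγ).ae_le (Measure.rnDeriv_mul_rnDeriv (κ := volume) hac),
          (hac.trans hγ).ae_le (rnDeriv_gaussianReal 0 1)] with x hx1 hx2 hx3 hx4
        refine ⟨ENNReal.toReal_pos hx1.ne' hx2, ?_⟩
        rw [← hx3, Pi.mul_apply, hx4, ENNReal.toReal_mul, toReal_gaussianPDF]
      filter_upwards [hmp.quasiMeasurePreserving.ae h1, ae_hasDerivAt_quantile ρ (hac.trans hγ)]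
        with u hu hu'
      exact ⟨_, hu.1, rfl, hu.2 ▸ hu'⟩
  obtain ⟨hμ1, hμ2, hμ3, hμ4⟩ := key μ hμ
  obtain ⟨hν1, hν2, hν3, hν4⟩ := key ν hν
  let G : ℝ → ℝ := fun u ↦ cdf γ ((quantile μ u + quantile ν u) / 2)
  have hG : MonotoneOn G (Ioo 0 1) := fun u hu v hv huv ↦ monotone_cdf γ <| by
    linarith [monotoneOn_quantile μ hu hv huv, monotoneOn_quantile ν hu hv huv]
  obtain ⟨hG1, hG2⟩ := hG.integral_deriv_Ioo_le_one (fun _ ↦ cdf_nonneg _ _)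
    (fun _ ↦ cdf_le_one _ _)
  have hle : ∀ᵐ u ∂(volume.restrict (Ioo (0 : ℝ) 1)), (quantile μ u - quantile ν u) ^ 2 ≤
      4 * (llr μ γ (quantile μ u) + llr ν γ (quantile ν u)) + 8 * (deriv G u - 1) := by
    filter_upwards [hμ4, hν4] with u ⟨f, hf, hf1, hf2⟩ ⟨g, hg, hg1, hg2⟩
    have hd : HasDerivAt G _ u := (hasDerivAt_cdf_gaussianReal _).comp u
      ((hf2.add hg2).div_const 2)
    rw [hd.deriv, hf1, hg1]
    exact sq_sub_le_log_add_log_add _ _ hf hg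
  have hi1 : IntegrableOn (fun u ↦ 4 * (llr μ γ (quantile μ u) + llr ν γ (quantile ν u)))
      (Ioo 0 1) := (hμ2.add hν2).const_mul 4
  have hi2 : IntegrableOn (fun u ↦ 8 * (deriv G u - 1)) (Ioo 0 1) :=
    (hG1.sub (integrable_const 1)).const_mul 8
  calc ∫⁻ u in Ioo (0 : ℝ) 1, ENNReal.ofReal ((quantile μ u - quantile ν u) ^ 2)
      ≤ ∫⁻ u in Ioo (0 : ℝ) 1, ENNReal.ofReal
          (4 * (llr μ γ (quantile μ u) + llr ν γ (quantile ν u)) + 8 * (deriv G u - 1)) :=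
        lintegral_mono_ae (hle.mono fun u hu ↦ ENNReal.ofReal_le_ofReal hu)
    _ = ENNReal.ofReal (∫ u in Ioo (0 : ℝ) 1,
          (4 * (llr μ γ (quantile μ u) + llr ν γ (quantile ν u)) + 8 * (deriv G u - 1))) :=
        (ofReal_integral_eq_lintegral_ofReal (hi1.add hi2)
          (hle.mono fun u hu ↦ (sq_nonneg _).trans hu)).symm
    _ ≤ ENNReal.ofReal (4 * (∫ u in Ioo (0 : ℝ) 1, llr μ γ (quantile μ u)) +
          4 * ∫ u in Ioo (0 : ℝ) 1, llr ν γ (quantile ν u)) := by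
        refine ENNReal.ofReal_le_ofReal ?_
        rw [integral_add hi1 hi2, integral_const_mul, integral_const_mul, integral_add hμ2 hν2,
          integral_sub hG1 (integrable_const 1)]
        simp only [integral_const, probReal_univ, smul_eq_mul, mul_one]
        linarith
    _ = 4 * (klDiv μ γ + klDiv ν γ) := by
        rw [hμ1, hν1, ENNReal.ofReal_add (by positivity) (by positivity),
          ENNReal.ofReal_mul (by norm_num), ENNReal.ofReal_mul (by norm_num), mul_add]
        norm_num

end OneDimensional

section Tensorization

open Set ProbabilityTheory InformationTheory
open scoped ENNReal NNReal

/-- The infimum of `∫⁻ p, c p ∂γ` over all couplings `γ` of `ρ` and `ν`. -/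
noncomputable def transportCost {α : Type*} [MeasurableSpace α] (c : α × α → ℝ≥0∞)
    (ρ ν : Measure α) : ℝ≥0∞ :=
  ⨅ (γ : Measure (α × α))
    (_ : IsProbabilityMeasure γ ∧ γ.map Prod.fst = ρ ∧ γ.map Prod.snd = ν), ∫⁻ p, c p ∂γ

theorem transportCost_le {α : Type*} [MeasurableSpace α] (c : α × α → ℝ≥0∞) {ρ ν : Measure α}
    (γ : Measure (α × α)) (hγ : IsProbabilityMeasure γ) (h1 : γ.map Prod.fst = ρ)
    (h2 : γ.map Prod.snd = ν) : transportCost c ρ ν ≤ ∫⁻ p, c p ∂γ :=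
  iInf₂_le γ ⟨hγ, h1, h2⟩

theorem transportCost_map_le {α β : Type*} [MeasurableSpace α] [MeasurableSpace β]
    (c : β × β → ℝ≥0∞) (hc : Measurable c) {f : α → β} (hf : Measurable f) (ρ ν : Measure α) :
    transportCost c (ρ.map f) (ν.map f) ≤ transportCost (fun p ↦ c (f p.1, f p.2)) ρ ν := by
  have hff : Measurable (Prod.map f f) := hf.prodMap hf
  refine le_iInf₂ fun γ ⟨hγ, h1, h2⟩ ↦
    (transportCost_le c (γ.map (Prod.map f f)) ?_ ?_ ?_).trans ?_
  · exact Measure.isProbabilityMeasure_map hff.aemeasurable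
  · rw [← h1, Measure.map_map measurable_fst hff, Measure.map_map hf measurable_fst]
    rfl
  · rw [← h2, Measure.map_map measurable_snd hff, Measure.map_map hf measurable_snd]
    rfl
  · rw [lintegral_map hc hff]
    rfl

theorem relEntropy_eq_klDiv {α : Type*} [MeasurableSpace α] (μ ν : Measure α)
    [IsFiniteMeasure μ] [IsFiniteMeasure ν] : relEntropy μ ν = klDiv μ ν := by
  rw [relEntropy, klDiv_eq_lintegral_klFun]
  simp only [klFun_apply, sub_add_eq_add_sub]

/-- The Kullback-Leibler divergence of composition-products with the same first marginal is the
average of the divergences of the kernels. -/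
theorem klDiv_compProd_right_eq_lintegral {α β : Type*} [MeasurableSpace α] [MeasurableSpace β]
    [MeasurableSpace.CountableOrCountablyGenerated α β] (μ : Measure α) [IsFiniteMeasure μ]
    (κ η : Kernel α β) [IsFiniteKernel κ] [IsFiniteKernel η] (h : μ ⊗ₘ κ ≪ μ ⊗ₘ η) :
    klDiv (μ ⊗ₘ κ) (μ ⊗ₘ η) =
      ∫⁻ a, ∫⁻ b, ENNReal.ofReal (klFun (κ.rnDeriv η a b).toReal) ∂η a ∂μ := by
  have hκ : ∀ᵐ a ∂μ, κ a = η.withDensity (κ.rnDeriv η) a := by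
    filter_upwards [h.kernel_of_compProd] with a ha using (Kernel.withDensity_rnDeriv_eq ha).symm
  have hd : (μ ⊗ₘ κ).rnDeriv (μ ⊗ₘ η) =ᵐ[μ ⊗ₘ η] fun p ↦ κ.rnDeriv η p.1 p.2 := by
    rw [Measure.compProd_congr hκ, Measure.compProd_withDensity (Kernel.measurable_rnDeriv κ η)]
    exact Measure.rnDeriv_withDensity _ (Kernel.measurable_rnDeriv κ η)
  rw [klDiv_eq_lintegral_klFun_of_ac h, ← Measure.lintegral_compProd (κ := η)
    (f := fun p ↦ ENNReal.ofReal (klFun (κ.rnDeriv η p.1 p.2).toReal))]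
  · exact lintegral_congr_ae (hd.mono fun p hp ↦ by simp only [hp])
  · exact (measurable_klFun.comp (Kernel.measurable_rnDeriv κ η).ennreal_toReal).ennreal_ofReal

/-- The chain rule for the entropy relative to a product measure. -/
theorem exists_measurable_klDiv_prod_eq {α : Type*} [MeasurableSpace α] (ρ : Measure (α × ℝ))
    [IsProbabilityMeasure ρ] (β : Measure α) [IsProbabilityMeasure β] (γ : Measure ℝ)
    [IsProbabilityMeasure γ] (h : klDiv ρ (β.prod γ) ≠ ∞) :
    ∃ g : α → ℝ≥0∞, Measurable g ∧ (∀ᵐ a ∂ρ.fst, klDiv (ρ.condKernel a) γ = g a) ∧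
      klDiv ρ (β.prod γ) = klDiv ρ.fst β + ∫⁻ a, g a ∂ρ.fst := by
  let η : Kernel α ℝ := Kernel.const α γ
  have hρ : ρ.fst ⊗ₘ ρ.condKernel = ρ := ρ.disintegrate ρ.condKernel
  have hβ : β ⊗ₘ η = β.prod γ := Measure.compProd_const
  have hac : ρ.fst ⊗ₘ ρ.condKernel ≪ β ⊗ₘ η := by
    rw [hρ, hβ]
    exact (klDiv_ne_top_iff.1 h).1
  have hac' := (Measure.absolutelyContinuous_compProd_iff.1 hac).2
  refine ⟨fun a ↦ ∫⁻ b, ENNReal.ofReal (klFun (ρ.condKernel.rnDeriv η a b).toReal) ∂γ, ?_, ?_, ?_⟩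
  · exact Measurable.lintegral_prod_right'
      (f := fun p : α × ℝ ↦ ENNReal.ofReal (klFun (ρ.condKernel.rnDeriv η p.1 p.2).toReal))
      (measurable_klFun.comp (Kernel.measurable_rnDeriv _ η).ennreal_toReal).ennreal_ofReal
  · filter_upwards [hac'.kernel_of_compProd] with a ha
    rw [Kernel.const_apply] at ha
    rw [klDiv_eq_lintegral_klFun_of_ac ha]
    have he : ρ.condKernel.rnDeriv η a =ᵐ[γ] (ρ.condKernel a).rnDeriv γ :=
      Kernel.rnDeriv_eq_rnDeriv_measure
    exact lintegral_congr_ae (he.mono fun b hb ↦ by simp only [hb])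
  · rw [← hβ]
    conv_lhs => rw [← hρ]
    rw [klDiv_compProd_eq_add, klDiv_compProd_right_eq_lintegral _ _ _ hac']
    rfl

/-- If transport costs on `α` are bounded by entropies relative to `β`, then the same holds on
`α × ℝ` for the product of `β` with the Gaussian. -/
theorem transportCost_prod_gaussianReal_le {α : Type*} [MeasurableSpace α] (β : Measure α)
    [IsProbabilityMeasure β] (c : α × α → ℝ≥0∞) (hc : Measurable c)
    (h : ∀ (ρ ν : Measure α) [IsProbabilityMeasure ρ] [IsProbabilityMeasure ν],
      transportCost c ρ ν ≤ 4 * (klDiv ρ β + klDiv ν β))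
    (ρ ν : Measure (α × ℝ)) [IsProbabilityMeasure ρ] [IsProbabilityMeasure ν] :
    transportCost (fun p ↦ c (p.1.1, p.2.1) + ENNReal.ofReal ((p.1.2 - p.2.2) ^ 2)) ρ ν ≤
      4 * (klDiv ρ (β.prod (gaussianReal 0 1)) + klDiv ν (β.prod (gaussianReal 0 1))) := by
  set γ := gaussianReal 0 1
  by_cases hρ : klDiv ρ (β.prod γ) = ∞
  · simp [hρ]
  by_cases hν : klDiv ν (β.prod γ) = ∞
  · simp [hν]
  obtain ⟨f, hf, hf1, hf2⟩ := exists_measurable_klDiv_prod_eq ρ β γ hρ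
  obtain ⟨g, hg, hg1, hg2⟩ := exists_measurable_klDiv_prod_eq ν β γ hν
  set lam : Measure ℝ := volume.restrict (Ioo (0 : ℝ) 1)
  have hQρ := measurable_quantile_kernel ρ.condKernel
  have hQν := measurable_quantile_kernel ν.condKernel
  have hmap (τ : Measure (α × ℝ)) [IsProbabilityMeasure τ] :
      (τ.fst.prod lam).map (fun p ↦ (p.1, quantile (τ.condKernel p.1) p.2)) = τ := by
    have hm : Measurable fun p : α × ℝ ↦ (p.1, quantile (τ.condKernel p.1) p.2) :=
      measurable_fst.prodMk (measurable_quantile_kernel τ.condKernel)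
    conv_rhs => rw [← τ.disintegrate τ.condKernel]
    ext s hs
    rw [Measure.map_apply hm hs, Measure.prod_apply (hm hs), Measure.compProd_apply hs]
    refine lintegral_congr fun a ↦ ?_
    conv_rhs => rw [← map_quantile (τ.condKernel a)]
    rw [Measure.map_apply (measurable_quantile _) (measurable_prodMk_left hs)]
    rfl
  have hglue : transportCost (fun p ↦ c (p.1.1, p.2.1) + ENNReal.ofReal ((p.1.2 - p.2.2) ^ 2)) ρ ν ≤
      transportCost c ρ.fst ν.fst + 4 * (∫⁻ a, f a ∂ρ.fst + ∫⁻ a, g a ∂ν.fst) := by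
    conv_rhs => simp only [transportCost, ENNReal.iInf_add]
    refine le_iInf₂ fun θ ⟨hθ, hθ1, hθ2⟩ ↦ ?_
    let T : (α × α) × ℝ → (α × ℝ) × (α × ℝ) := fun q ↦
      ((q.1.1, quantile (ρ.condKernel q.1.1) q.2), (q.1.2, quantile (ν.condKernel q.1.2) q.2))
    have hT1 : Measurable fun q : (α × α) × ℝ ↦ quantile (ρ.condKernel q.1.1) q.2 :=
      hQρ.comp (measurable_fst.fst.prodMk measurable_snd)
    have hT2 : Measurable fun q : (α × α) × ℝ ↦ quantile (ν.condKernel q.1.2) q.2 :=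
      hQν.comp (measurable_fst.snd.prodMk measurable_snd)
    have hT : Measurable T :=
      (measurable_fst.fst.prodMk hT1).prodMk (measurable_fst.snd.prodMk hT2)
    have hfst : (θ.prod lam).map (fun q ↦ (q.1.1, q.2)) = ρ.fst.prod lam := by
      rw [← hθ1]
      have := Measure.map_prod_map θ lam measurable_fst measurable_id
      rw [Measure.map_id] at this
      exact this.symm
    have hsnd : (θ.prod lam).map (fun q ↦ (q.1.2, q.2)) = ν.fst.prod lam := by
      rw [← hθ2]
      have := Measure.map_prod_map θ lam measurable_snd measurable_id
      rw [Measure.map_id] at this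
      exact this.symm
    refine (transportCost_le _ ((θ.prod lam).map T) ?_ ?_ ?_).trans ?_
    · exact Measure.isProbabilityMeasure_map hT.aemeasurable
    · conv_rhs => rw [← hmap ρ, ← hfst]
      rw [Measure.map_map measurable_fst hT, Measure.map_map (measurable_fst.prodMk hQρ)
        (measurable_fst.fst.prodMk measurable_snd)]
      rfl
    · conv_rhs => rw [← hmap ν, ← hsnd]
      rw [Measure.map_map measurable_snd hT, Measure.map_map (measurable_fst.prodMk hQν)
        (measurable_fst.snd.prodMk measurable_snd)]
      rfl
    · have hsq : Measurable fun q : (α × α) × ℝ ↦ ENNReal.ofReal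
          ((quantile (ρ.condKernel q.1.1) q.2 - quantile (ν.condKernel q.1.2) q.2) ^ 2) :=
        ((hT1.sub hT2).pow_const 2).ennreal_ofReal
      have hcf : Measurable fun q : (α × α) × ℝ ↦ c q.1 := hc.comp measurable_fst
      have hcost : Measurable fun p : (α × ℝ) × (α × ℝ) ↦
          c (p.1.1, p.2.1) + ENNReal.ofReal ((p.1.2 - p.2.2) ^ 2) :=
        (hc.comp (measurable_fst.fst.prodMk measurable_snd.fst)).add
          ((measurable_fst.snd.sub measurable_snd.snd).pow_const 2).ennreal_ofReal
      rw [lintegral_map hcost hT]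
      change ∫⁻ q, (c q.1 + ENNReal.ofReal ((quantile (ρ.condKernel q.1.1) q.2 -
        quantile (ν.condKernel q.1.2) q.2) ^ 2)) ∂(θ.prod lam) ≤ _
      rw [lintegral_add_left hcf, lintegral_prod _ hsq.aemeasurable,
        lintegral_prod _ hcf.aemeasurable]
      simp only [lintegral_const, measure_univ, mul_one]
      gcongr
      have hfρ : ∀ᵐ p ∂θ, klDiv (ρ.condKernel p.1) γ = f p.1 :=
        ae_of_ae_map measurable_fst.aemeasurable (hθ1 ▸ hf1)
      have hgν : ∀ᵐ p ∂θ, klDiv (ν.condKernel p.2) γ = g p.2 :=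
        ae_of_ae_map measurable_snd.aemeasurable (hθ2 ▸ hg1)
      calc _ ≤ ∫⁻ p, 4 * (f p.1 + g p.2) ∂θ := by
            refine lintegral_mono_ae ?_
            filter_upwards [hfρ, hgν] with p hp1 hp2
            rw [← hp1, ← hp2]
            exact lintegral_sq_sub_quantile_le _ _
        _ = _ := by
            rw [lintegral_const_mul _ (by fun_prop), lintegral_add_left (by fun_prop), ← hθ1, ← hθ2,
              lintegral_map hf measurable_fst, lintegral_map hg measurable_snd]
  grw [hglue, h ρ.fst ν.fst, hf2, hg2, ← mul_add, add_add_add_comm]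

end Tensorization

section Gaussian

open Set ProbabilityTheory InformationTheory
open scoped ENNReal NNReal

/-- Splitting off the first coordinate of a vector in `ℝ^(n+1)`. -/
def finSuccProdEquiv (n : ℕ) : (Fin (n + 1) → ℝ) ≃ᵐ (Fin n → ℝ) × ℝ :=
  (MeasurableEquiv.piFinSuccAbove (fun _ ↦ ℝ) 0).trans MeasurableEquiv.prodComm

theorem measurePreserving_finSuccProdEquiv (n : ℕ) : MeasurePreserving (finSuccProdEquiv n) :=
  Measure.measurePreserving_swap.comp (volume_preserving_piFinSuccAbove (fun _ ↦ ℝ) 0)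

theorem map_stdGaussian_succ (n : ℕ) :
    (_root_.stdGaussian (n + 1)).map (finSuccProdEquiv n) =
      (_root_.stdGaussian n).prod (gaussianReal 0 1) := by
  have hm : Measurable fun x : Fin n → ℝ ↦
      ENNReal.ofReal ((2 * π) ^ (-(n : ℝ) / 2) * Real.exp (-(∑ i, x i ^ 2) / 2)) := by fun_prop
  rw [gaussianReal_of_var_ne_zero 0 one_ne_zero, _root_.stdGaussian, _root_.stdGaussian,
    prod_withDensity hm (measurable_gaussianPDF 0 1), ← Measure.volume_eq_prod]
  ext s hs
  rw [Measure.map_apply (finSuccProdEquiv n).measurable hs, withDensity_apply _ hs,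
    withDensity_apply _ ((finSuccProdEquiv n).measurable hs),
    ← (measurePreserving_finSuccProdEquiv n).setLIntegral_comp_preimage_emb
      (finSuccProdEquiv n).measurableEmbedding]
  refine lintegral_congr fun x ↦ ?_
  rw [gaussianPDF, ← ENNReal.ofReal_mul (by positivity)]
  congr 1
  have h1 : (finSuccProdEquiv n x).1 = fun i ↦ x i.succ := rfl
  have h2 : (finSuccProdEquiv n x).2 = x 0 := rfl
  have h3 : ((2 : ℝ) * π) ^ (-((n + 1 : ℕ) : ℝ) / 2) =
      (2 * π) ^ (-(n : ℝ) / 2) * (√(2 * π))⁻¹ := by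
    rw [Real.sqrt_eq_rpow, ← Real.rpow_neg (by positivity), ← Real.rpow_add (by positivity)]
    push_cast
    ring_nf
  rw [h1, h2, gaussianPDFReal, h3, Fin.sum_univ_succ]
  simp only [NNReal.coe_one, mul_one, sub_zero]
  rw [mul_mul_mul_comm, ← Real.exp_add]
  ring_nf

instance isProbabilityMeasure_stdGaussian (n : ℕ) :
    IsProbabilityMeasure (_root_.stdGaussian n) := by
  induction n with
  | zero =>
    constructor
    simp [_root_.stdGaussian, volume_pi]
  | succ n ih =>
    constructor
    have h := congrArg (fun μ ↦ μ univ) (map_stdGaussian_succ n)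
    simpa [Measure.map_apply (finSuccProdEquiv n).measurable MeasurableSet.univ] using h

theorem transportCost_stdGaussian_le (n : ℕ) (ρ ν : Measure (Fin n → ℝ))
    [IsProbabilityMeasure ρ] [IsProbabilityMeasure ν] :
    transportCost (fun p : (Fin n → ℝ) × (Fin n → ℝ) ↦
        ENNReal.ofReal (∑ i, (p.1 i - p.2 i) ^ 2)) ρ ν ≤
      4 * (klDiv ρ (_root_.stdGaussian n) + klDiv ν (_root_.stdGaussian n)) := by
  induction n with
  | zero =>
    refine (transportCost_le _ (ρ.prod ν) inferInstance (by simp) (by simp)).trans ?_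
    simp
  | succ n ih =>
    let e := finSuccProdEquiv n
    have : IsProbabilityMeasure (ρ.map e) :=
      Measure.isProbabilityMeasure_map e.measurable.aemeasurable
    have : IsProbabilityMeasure (ν.map e) :=
      Measure.isProbabilityMeasure_map e.measurable.aemeasurable
    have hρ : (ρ.map e).map e.symm = ρ := e.map_symm_map
    have hν : (ν.map e).map e.symm = ν := e.map_symm_map
    have hc (p : ((Fin n → ℝ) × ℝ) × ((Fin n → ℝ) × ℝ)) :
        ENNReal.ofReal (∑ i, (e.symm p.1 i - e.symm p.2 i) ^ 2) =
          ENNReal.ofReal (∑ i, (p.1.1 i - p.2.1 i) ^ 2) +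
            ENNReal.ofReal ((p.1.2 - p.2.2) ^ 2) := by
      rw [← ENNReal.ofReal_add (by positivity) (by positivity), Fin.sum_univ_succ, add_comm]
      rfl
    calc
      _ = transportCost (fun p : (Fin (n + 1) → ℝ) × (Fin (n + 1) → ℝ) ↦
        ENNReal.ofReal (∑ i, (p.1 i - p.2 i) ^ 2))
          ((ρ.map e).map e.symm) ((ν.map e).map e.symm) := by rw [hρ, hν]
      _ ≤ _ := transportCost_map_le _ (by fun_prop) e.symm.measurable _ _
      _ ≤ 4 * (klDiv (ρ.map e) ((_root_.stdGaussian n).prod (gaussianReal 0 1)) +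
          klDiv (ν.map e) ((_root_.stdGaussian n).prod (gaussianReal 0 1))) := by
        simp only [hc]
        exact transportCost_prod_gaussianReal_le (_root_.stdGaussian n)
          (fun p : (Fin n → ℝ) × (Fin n → ℝ) ↦
        ENNReal.ofReal (∑ i, (p.1 i - p.2 i) ^ 2)) (by fun_prop)
          (fun ρ ν _ _ ↦ ih ρ ν) _ _
      _ ≤ _ := by
        rw [← map_stdGaussian_succ n]
        gcongr <;> exact klDiv_map_le _ _ e.measurable

end Gaussian

/-- Talagrand-type inequality: the squared 2-Wasserstein distance
between `ρ` and `ν` is at most `4(H(ρ|β) + H(ν|β))`, as an inequality in `[0, ∞]`. -/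
theorem wasserstein_squared_le_entropies (n : ℕ)
    (ρ ν : Measure (Fin n → ℝ))
    [IsProbabilityMeasure ρ] [IsProbabilityMeasure ν] :
    (⨅ (γ : Measure ((Fin n → ℝ) × (Fin n → ℝ)))
        (_ : IsProbabilityMeasure γ ∧ γ.map Prod.fst = ρ ∧ γ.map Prod.snd = ν),
        ∫⁻ p, ENNReal.ofReal (∑ i, (p.1 i - p.2 i) ^ 2) ∂γ)
      ≤ 4 * (relEntropy ρ (stdGaussian n) + relEntropy ν (stdGaussian n)) := by
  rw [relEntropy_eq_klDiv, relEntropy_eq_klDiv]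
  exact transportCost_stdGaussian_le n ρ ν
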